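/- arXiv:1602.07493 — 2 statements merged into one kernel-verified Lean document; each statement's English description precedes it below -/
import Mathlib

section
/- Commutator norm estimate (bounded version): Let 𝓗 be a complex Hilbert space, B and H bounded self-adjoint operators on 𝓗, F : ℝ → ℂ a compactly supported smooth function, and F̃ an almost analytic extension of F. Then for every ε > 0, with C_ε := π^{-1} ∫_ℂ ⟨z⟩^{-2-ε} du dv < ∞ and ⟨z⟩ = (1+|z|²)^{1/2}, one has ‖[H, F(B)]‖ ≤ C_ε · sup_{z∈ℂ} ( ⟨z⟩^{ε+2} |Im z|^{-2} |(∂̄F̃)(z)| ) · ‖[H, B]‖, where the supremum is finite. -/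
open MeasureTheory

/-- The Cauchy–Riemann operator `∂̄ = (1/2)(∂_u + i ∂_v)` acting on functions of
`z = u + iv ∈ ℂ`, viewed as smooth functions of the two real variables `u, v`. -/
noncomputable def dbar (f : ℂ → ℂ) (z : ℂ) : ℂ :=
  (1 / 2) * (fderiv ℝ f z 1 + Complex.I * fderiv ℝ f z Complex.I)

/-- Green/Pompeiu formula at the origin. -/
lemma pompeiu_zero (g : ℂ → ℂ) (hg : ContDiff ℝ 1 g) (hs : HasCompactSupport g) :
    ∫ z : ℂ, dbar g z / z = -(Real.pi : ℂ) * g 0 := by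
  have hdiff : Differentiable ℝ g := hg.differentiable (by norm_num)
  have hcont : Continuous (fderiv ℝ g) := hg.continuous_fderiv (by norm_num)
  obtain ⟨R, hR⟩ := hs.isCompact.isBounded.exists_norm_le
  have hzero : ∀ z : ℂ, R < ‖z‖ → g z = 0 := by
    intro z hz
    by_contra h
    exact absurd (hR z (subset_tsupport g h)) (not_le.2 hz)
  have hdzero : ∀ z : ℂ, R < ‖z‖ → fderiv ℝ g z = 0 := by
    intro z hz
    by_contra h
    exact absurd (hR z (support_fderiv_subset ℝ h)) (not_le.2 hz)
  let e : ℝ → ℂ := fun θ => Real.cos θ + Real.sin θ * Complex.I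
  have hen : ∀ θ, ‖e θ‖ = 1 := by
    intro θ
    simp only [e]
    rw [Complex.ofReal_cos, Complex.ofReal_sin, Complex.norm_cos_add_sin_mul_I]
  have hec : Continuous e := by fun_prop
  let P : ℝ × ℝ → ℂ := fun p => fderiv ℝ g (p.1 * e p.2) (e p.2)
  let Q : ℝ × ℝ → ℂ := fun p => fderiv ℝ g (p.1 * e p.2) (Complex.I * e p.2)
  have hPc : Continuous P := by
    refine Continuous.clm_apply (hcont.comp (by fun_prop)) (by fun_prop)
  have hQc : Continuous Q := by
    refine Continuous.clm_apply (hcont.comp (by fun_prop)) (by fun_prop)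
  have hint : ∀ T : ℝ × ℝ → ℂ, Continuous T → (∀ p : ℝ × ℝ, 0 < p.1 → R < p.1 → T p = 0) →
      IntegrableOn T (Set.Ioi (0 : ℝ) ×ˢ Set.Ioo (-Real.pi) Real.pi) := by
    intro T hT h0
    have h1 : IntegrableOn T (Set.Icc (0 : ℝ) R ×ˢ Set.Icc (-Real.pi) Real.pi) :=
      hT.continuousOn.integrableOn_compact (isCompact_Icc.prod isCompact_Icc)
    refine h1.of_forall_sdiff_eq_zero (measurableSet_Ioi.prod measurableSet_Ioo) ?_
    rintro ⟨r, θ⟩ ⟨⟨h2, h3⟩, h4⟩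
    simp only [Set.mem_Ioi] at h2
    refine h0 _ h2 ?_
    by_contra h5
    exact h4 ⟨⟨h2.le, not_lt.1 h5⟩, h3.1.le, h3.2.le⟩
  have hnorm : ∀ p : ℝ × ℝ, 0 < p.1 → ‖(p.1 * e p.2 : ℂ)‖ = p.1 := by
    intro p hp
    rw [norm_mul, hen, mul_one, Complex.norm_real, Real.norm_of_nonneg hp.le]
  have hPi := hint P hPc (fun p h1 h2 => by
    simp only [P]; rw [hdzero _ (by rwa [hnorm p h1])]; simp)
  have hQi := hint Q hQc (fun p h1 h2 => by
    simp only [Q]; rw [hdzero _ (by rwa [hnorm p h1])]; simp)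
  have hPint : ∫ p in Set.Ioi (0 : ℝ) ×ˢ Set.Ioo (-Real.pi) Real.pi, P p
      = -(2 * Real.pi : ℂ) * g 0 := by
    have hPi' := hPi
    rw [IntegrableOn, Measure.volume_eq_prod, ← Measure.prod_restrict] at hPi'
    rw [Measure.volume_eq_prod, ← Measure.prod_restrict, integral_prod_symm _ hPi']
    have : ∀ θ : ℝ, ∫ r in Set.Ioi (0 : ℝ), P (r, θ) = - g 0 := by
      intro θ
      have hd : ∀ r : ℝ, HasDerivAt (fun r : ℝ => g (r * e θ)) (P (r, θ)) r := by
        intro r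
        have h1 : HasDerivAt (fun r : ℝ => (r : ℂ) * e θ) (1 * e θ) r :=
          (Complex.ofRealCLM.hasDerivAt (x := r)).mul_const (e θ)
        rw [one_mul] at h1
        exact (hdiff (r * e θ)).hasFDerivAt.comp_hasDerivAt r h1
      have h2 : IntegrableOn (fun r => P (r, θ)) (Set.Ioi 0) := by
        have h1 : IntegrableOn (fun r => P (r, θ)) (Set.Icc 0 R) :=
          (hPc.comp (by fun_prop : Continuous fun r : ℝ => (r, θ))).continuousOn.integrableOn_compact
            isCompact_Icc
        refine h1.of_forall_sdiff_eq_zero measurableSet_Ioi ?_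
        rintro r ⟨h2, h4⟩
        have h5 : R < r := by
          by_contra h5
          exact h4 ⟨(Set.mem_Ioi.1 h2).le, not_lt.1 h5⟩
        simp only [P]; rw [hdzero _ (by rwa [hnorm (r, θ) h2])]; simp
      have h3 : Filter.Tendsto (fun r : ℝ => g (r * e θ)) Filter.atTop (nhds 0) := by
        refine tendsto_const_nhds.congr' ?_
        filter_upwards [Filter.eventually_gt_atTop R, Filter.eventually_gt_atTop 0] with r h1 h2
        exact (hzero _ (by rwa [hnorm (r, θ) h2])).symm
      rw [integral_Ioi_of_hasDerivAt_of_tendsto' (fun x _ => hd x) h2 h3]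
      simp
    simp_rw [this]
    have hp := Real.pi_pos
    simp [Measure.real, Real.volume_Ioo]
    rw [ENNReal.toReal_ofReal (by positivity)]
    left
    push_cast; ring
  have hQint : ∫ p in Set.Ioi (0 : ℝ) ×ˢ Set.Ioo (-Real.pi) Real.pi, Q p = 0 := by
    rw [Measure.volume_eq_prod] at hQi ⊢
    rw [setIntegral_prod _ hQi]
    have : ∀ r ∈ Set.Ioi (0 : ℝ), ∫ θ in Set.Ioo (-Real.pi) Real.pi, Q (r, θ) = 0 := by
      intro r hr
      have hr0 : (r : ℂ) ≠ 0 := by exact_mod_cast (Set.mem_Ioi.1 hr).ne'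
      have hd : ∀ θ : ℝ, HasDerivAt (fun θ : ℝ => g (r * e θ)) (r * Q (r, θ)) θ := by
        intro θ
        have h1 : HasDerivAt e (Complex.I * e θ) θ := by
          have h2 : HasDerivAt e
              (((-Real.sin θ : ℝ) : ℂ) + ((Real.cos θ : ℝ) : ℂ) * Complex.I) θ :=
            (Real.hasDerivAt_cos θ).ofReal_comp.add
              ((Real.hasDerivAt_sin θ).ofReal_comp.mul_const Complex.I)
          convert h2 using 1
          simp only [e]
          push_cast
          linear_combination Complex.sin θ * Complex.I_mul_I
        have h3 : HasDerivAt (fun θ => (r : ℂ) * e θ) (r * (Complex.I * e θ)) θ :=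
          h1.const_mul (r : ℂ)
        have h4 := (hdiff (r * e θ)).hasFDerivAt.comp_hasDerivAt θ h3
        have h7 : (r : ℂ) * Q (r, θ) = fderiv ℝ g (r * e θ) (r * (Complex.I * e θ)) := by
          change (r : ℂ) * fderiv ℝ g (r * e θ) (Complex.I * e θ) =
            fderiv ℝ g (r * e θ) (r * (Complex.I * e θ))
          generalize fderiv ℝ g (r * e θ) = D
          rw [← Complex.real_smul, ← Complex.real_smul, map_smul]
        rw [h7]
        exact h4
      have hc : Continuous (fun θ => (r : ℂ) * Q (r, θ)) := by
        exact continuous_const.mul (hQc.comp (by fun_prop))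
      have h5 := intervalIntegral.integral_eq_sub_of_hasDerivAt (a := -Real.pi) (b := Real.pi)
        (fun θ _ => hd θ) (hc.intervalIntegrable _ _)
      have h6 : e (-Real.pi) = e Real.pi := by simp [e]
      rw [h6, sub_self, intervalIntegral.integral_const_mul] at h5
      rw [← integral_Ioc_eq_integral_Ioo,
        ← intervalIntegral.integral_of_le (by linarith [Real.pi_pos])]
      exact (mul_eq_zero.1 h5).resolve_left hr0
    rw [setIntegral_congr_fun measurableSet_Ioi this]
    simp
  rw [← Complex.integral_comp_polarCoord_symm, polarCoord_target]
  have hcongr : ∀ p ∈ Set.Ioi (0 : ℝ) ×ˢ Set.Ioo (-Real.pi) Real.pi,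
      p.1 • (dbar g (Complex.polarCoord.symm p) / Complex.polarCoord.symm p)
        = (1 / 2) * (P p + Complex.I * Q p) := by
    rintro ⟨r, θ⟩ ⟨hr, -⟩
    have hr0 : (r : ℂ) ≠ 0 := by exact_mod_cast (Set.mem_Ioi.1 hr).ne'
    have he0 : e θ ≠ 0 := by
      intro h; have := hen θ; rw [h] at this; simp at this
    rw [Complex.polarCoord_symm_apply]
    change r • (dbar g (r * e θ) / (r * e θ)) = _
    simp only [P, Q, dbar]
    set D := fderiv ℝ g (r * e θ)
    have hD1 : D (e θ) = Real.cos θ * D 1 + Real.sin θ * D Complex.I := by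
      have : e θ = Real.cos θ • (1 : ℂ) + Real.sin θ • Complex.I := by
        simp [e]
      rw [this, map_add, map_smul, map_smul, Complex.real_smul, Complex.real_smul]
    have hD2 : D (Complex.I * e θ) = -Real.sin θ * D 1 + Real.cos θ * D Complex.I := by
      have : Complex.I * e θ = (-Real.sin θ) • (1 : ℂ) + Real.cos θ • Complex.I := by
        simp only [e, Complex.real_smul]
        push_cast
        linear_combination Complex.sin θ * Complex.I_mul_I
      rw [this, map_add, map_smul, map_smul, Complex.real_smul, Complex.real_smul]
      push_cast; rfl
    rw [hD1, hD2, Complex.real_smul]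
    field_simp
    simp only [e]
    have hcs : (Real.cos θ : ℂ) ^ 2 + (Real.sin θ : ℂ) ^ 2 = 1 := by
      exact_mod_cast Real.cos_sq_add_sin_sq θ
    have hI := Complex.I_mul_I
    generalize D 1 = a
    generalize D Complex.I = b
    generalize (Real.cos θ : ℂ) = c at *
    generalize (Real.sin θ : ℂ) = s at *
    have hI2 : Complex.I ^ 2 = -1 := Complex.I_sq
    have hI3 : Complex.I ^ 3 = -Complex.I := by rw [pow_succ, hI2]; ring
    ring_nf
    simp only [hI2, hI3]
    linear_combination -(a + Complex.I * b) * hcs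
  rw [setIntegral_congr_fun (measurableSet_Ioi.prod measurableSet_Ioo) hcongr,
    integral_const_mul, integral_add hPi (hQi.const_mul _), integral_const_mul, hPint, hQint]
  ring

lemma pompeiu (f : ℂ → ℂ) (hf : ContDiff ℝ 1 f) (hs : HasCompactSupport f) (w : ℂ) :
    f w = (Real.pi : ℂ)⁻¹ * ∫ z : ℂ, dbar f z / (w - z) := by
  have h := pompeiu_zero (fun z => f (w + z)) (hf.comp (by fun_prop))
    (hs.comp_homeomorph (Homeomorph.addLeft w))
  have h2 : ∀ z, dbar (fun z => f (w + z)) z / z = (fun z => dbar f z / (z - w)) (w + z) := by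
    intro z
    simp only [dbar, fderiv_comp_add_left, add_sub_cancel_left]
  simp_rw [h2] at h
  rw [integral_add_left_eq_self (fun z => dbar f z / (z - w)) w] at h
  have h3 : ∀ z, dbar f z / (w - z) = -(dbar f z / (z - w)) := by
    intro z; rw [← neg_sub z w, div_neg]
  simp_rw [h3]
  rw [integral_neg, h]
  have : (Real.pi : ℂ) ≠ 0 := by exact_mod_cast Real.pi_ne_zero
  simp [this]

/-- Commutator with a resolvent. -/
lemma resolvent_commutator {A : Type*} [Ring A] [Algebra ℂ A] (B H R : A) (z : ℂ)
    (h1 : R * (B - algebraMap ℂ A z) = 1) (h2 : (B - algebraMap ℂ A z) * R = 1) :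
    H * R - R * H = R * (B * H - H * B) * R := by
  have hc : algebraMap ℂ A z * H = H * algebraMap ℂ A z := Algebra.commutes z H
  have e : B * H - H * B = (B - algebraMap ℂ A z) * H - H * (B - algebraMap ℂ A z) := by
    rw [sub_mul, mul_sub, hc]; abel
  rw [e, mul_sub, sub_mul, ← mul_assoc, h1, one_mul, mul_assoc R, mul_assoc H, h2, mul_one]

lemma resolvent_facts {𝓗 : Type*} [NormedAddCommGroup 𝓗] [InnerProductSpace ℂ 𝓗]
    [CompleteSpace 𝓗] (B H : 𝓗 →L[ℂ] 𝓗) (hB : IsSelfAdjoint B) (z : ℂ) (hz : z.im ≠ 0) :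
    ‖H * cfc (fun x : ℂ => ((x.re : ℂ) - z)⁻¹) B - cfc (fun x : ℂ => ((x.re : ℂ) - z)⁻¹) B * H‖
      ≤ (|z.im| ^ 2)⁻¹ * ‖H * B - B * H‖ := by
  have hN : IsStarNormal B := hB.isStarNormal
  have hne : ∀ x : ℂ, (x.re : ℂ) - z ≠ 0 := by
    intro x h
    apply hz
    have := congrArg Complex.im h
    simpa using this
  have hcR : Continuous (fun x : ℂ => ((x.re : ℂ) - z)⁻¹) :=
    Continuous.inv₀ (by fun_prop) hne
  have hcB : Continuous (fun x : ℂ => (x.re : ℂ) - z) := by fun_prop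
  have hBz : cfc (fun x : ℂ => (x.re : ℂ) - z) B = B - algebraMap ℂ _ z := by
    have h1 : cfc (fun x : ℂ => (x.re : ℂ) - z) B = cfc (fun x : ℂ => x - z) B := by
      refine cfc_congr fun x hx => ?_
      have : (x.re : ℂ) = x := (hB.mem_spectrum_eq_re hx).symm
      simp [this]
    rw [h1, cfc_sub (fun x : ℂ => x) (fun _ => z) B, cfc_id' ℂ B, cfc_const z B]
  set R := cfc (fun x : ℂ => ((x.re : ℂ) - z)⁻¹) B with hR
  have h1 : R * (B - algebraMap ℂ _ z) = 1 := by
    rw [← hBz, hR, ← cfc_mul _ _ B hcR.continuousOn hcB.continuousOn]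
    rw [← cfc_one ℂ B]
    refine cfc_congr fun x hx => ?_
    simp [hne x]
  have h2 : (B - algebraMap ℂ _ z) * R = 1 := by
    rw [← hBz, hR, ← cfc_mul _ _ B hcB.continuousOn hcR.continuousOn]
    rw [← cfc_one ℂ B]
    refine cfc_congr fun x hx => ?_
    simp [hne x]
  have hRn : ‖R‖ ≤ |z.im|⁻¹ := by
    refine norm_cfc_le (by positivity) fun x hx => ?_
    rw [norm_inv]
    refine inv_anti₀ (abs_pos.2 hz) ?_
    have := Complex.abs_im_le_norm ((x.re : ℂ) - z)
    simpa using this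
  rw [resolvent_commutator B H R z h1 h2]
  calc ‖R * (B * H - H * B) * R‖ ≤ ‖R‖ * ‖B * H - H * B‖ * ‖R‖ :=
        (norm_mul_le _ _).trans (by gcongr; exact norm_mul_le _ _)
    _ ≤ |z.im|⁻¹ * ‖B * H - H * B‖ * |z.im|⁻¹ := by gcongr
    _ = (|z.im| ^ 2)⁻¹ * ‖H * B - B * H‖ := by rw [norm_sub_rev]; ring

/-- **commutator norm estimate, bounded version.** For bounded self-adjoint
`B, H`, compactly supported smooth `F` and an almost analytic extension `F̃` of `F`, and any
`ε > 0`: with `C_ε = π⁻¹ ∫_ℂ ⟨z⟩^{-2-ε} du dv < ∞` (i.e. the weight is integrable) one has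
`‖[H, F(B)]‖ ≤ C_ε · sup_z (⟨z⟩^{ε+2} |Im z|⁻² |∂̄F̃(z)|) · ‖[H, B]‖`, the supremum being
finite; here `⟨z⟩ = (1 + |z|²)^{1/2}` and `[S, T] = S T - T S`. -/
theorem commutator_norm_estimate_bounded
    {𝓗 : Type*} [NormedAddCommGroup 𝓗] [InnerProductSpace ℂ 𝓗] [CompleteSpace 𝓗]
    (B H : 𝓗 →L[ℂ] 𝓗) (hB : IsSelfAdjoint B) (hH : IsSelfAdjoint H)
    (F : ℝ → ℂ) (hF : ContDiff ℝ (⊤ : ℕ∞) F) (hFsupp : HasCompactSupport F)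
    (Ftil : ℂ → ℂ) (hFt : ContDiff ℝ (⊤ : ℕ∞) Ftil) (hFtsupp : HasCompactSupport Ftil)
    (hext : ∀ x : ℝ, Ftil (x : ℂ) = F x)
    (haa : ∀ k : ℕ, ∃ C : ℝ, ∀ z : ℂ, ‖dbar Ftil z‖ ≤ C * |z.im| ^ k)
    (ε : ℝ) (hε : 0 < ε) :
    Integrable (fun z : ℂ => (1 + ‖z‖ ^ 2) ^ ((-2 - ε) / 2)) ∧
    BddAbove (Set.range fun z : ℂ =>
      (1 + ‖z‖ ^ 2) ^ ((ε + 2) / 2) * (|z.im| ^ 2)⁻¹ * ‖dbar Ftil z‖) ∧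
    ‖H * cfc (fun z : ℂ => F z.re) B - cfc (fun z : ℂ => F z.re) B * H‖ ≤
      ((Real.pi)⁻¹ * ∫ z : ℂ, (1 + ‖z‖ ^ 2) ^ ((-2 - ε) / 2)) *
        (⨆ z : ℂ, (1 + ‖z‖ ^ 2) ^ ((ε + 2) / 2) * (|z.im| ^ 2)⁻¹ * ‖dbar Ftil z‖) *
        ‖H * B - B * H‖ := by
  have hFt1 : ContDiff ℝ 1 Ftil := hFt.of_le (by exact_mod_cast le_top)
  have hdc : Continuous (dbar Ftil) := by
    have := hFt1.continuous_fderiv (by norm_num)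
    unfold dbar
    fun_prop
  have hds : HasCompactSupport (dbar Ftil) := by
    refine hFtsupp.mono' ?_
    intro z hz
    apply support_fderiv_subset ℝ
    intro h
    apply hz
    simp [dbar, h]
  obtain ⟨C, hC⟩ := haa 2
  have hC0 : 0 ≤ C := by
    have := (norm_nonneg _).trans (hC Complex.I)
    simpa using this
  have hreal : ∀ z : ℂ, z.im = 0 → dbar Ftil z = 0 := by
    intro z hz
    have := hC z
    rw [hz] at this
    simpa using this
  have hI1 : Integrable (fun z : ℂ => (1 + ‖z‖ ^ 2) ^ ((-2 - ε) / 2)) := by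
    have := integrable_rpow_neg_one_add_norm_sq (E := ℂ) (μ := volume) (r := 2 + ε)
      (by rw [Complex.finrank_real_complex]; push_cast; linarith)
    convert this using 4
    ring
  have hbdd : BddAbove (Set.range fun z : ℂ =>
      (1 + ‖z‖ ^ 2) ^ ((ε + 2) / 2) * (|z.im| ^ 2)⁻¹ * ‖dbar Ftil z‖) := by
    have hw : Continuous (fun z : ℂ => (1 + ‖z‖ ^ 2) ^ ((ε + 2) / 2)) := by
      refine Continuous.rpow_const (by fun_prop) fun z => Or.inl (by positivity)
    obtain ⟨M, hM⟩ := hds.isCompact.exists_bound_of_continuousOn hw.continuousOn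
    refine ⟨max (M * C) 0, ?_⟩
    rintro _ ⟨z, rfl⟩
    dsimp only
    by_cases hz : dbar Ftil z = 0
    · simp [hz]
    have him : z.im ≠ 0 := fun h => hz (hreal z h)
    refine le_max_of_le_left ?_
    rw [mul_assoc]
    have hM' := hM z (subset_tsupport _ hz)
    rw [Real.norm_of_nonneg (by positivity)] at hM'
    refine mul_le_mul hM' ?_ (by positivity) (le_trans (by positivity) hM')
    have : 0 < |z.im| ^ 2 := by positivity
    rw [inv_mul_le_iff₀ this, mul_comm]
    exact hC z
  refine ⟨hI1, hbdd, ?_⟩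
  set S := ⨆ z : ℂ, (1 + ‖z‖ ^ 2) ^ ((ε + 2) / 2) * (|z.im| ^ 2)⁻¹ * ‖dbar Ftil z‖ with hS
  have hN : IsStarNormal B := hB.isStarNormal
  let G : ℂ → ℂ → ℂ := fun z x => dbar Ftil z * ((x.re : ℂ) - z)⁻¹
  have him_le : ∀ z x : ℂ, |z.im| ≤ ‖(x.re : ℂ) - z‖ := by
    intro z x
    have := Complex.abs_im_le_norm ((x.re : ℂ) - z)
    simpa using this
  have hGb : ∀ z x, ‖G z x‖ ≤ C * |z.im| := by
    intro z x
    by_cases h : z.im = 0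
    · simp [G, hreal z h, h]
    have hp : 0 < |z.im| := abs_pos.2 h
    simp only [G]
    rw [norm_mul, norm_inv, ← div_eq_mul_inv, div_le_iff₀ (hp.trans_le (him_le z x))]
    calc ‖dbar Ftil z‖ ≤ C * |z.im| ^ 2 := hC z
      _ = C * |z.im| * |z.im| := by ring
      _ ≤ _ := by gcongr; exact him_le z x
  have hGc : Continuous (Function.uncurry G) := by
    rw [continuous_iff_continuousAt]
    rintro ⟨z, x⟩
    by_cases h : z.im = 0
    · have h0 : Function.uncurry G (z, x) = 0 := by simp [G, hreal z h]
      rw [ContinuousAt, h0]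
      refine squeeze_zero_norm (a := fun p : ℂ × ℂ => C * |p.1.im|) (fun p => hGb p.1 p.2) ?_
      have : Continuous (fun p : ℂ × ℂ => C * |p.1.im|) := by fun_prop
      have h2 := this.tendsto (z, x)
      simpa [h] using h2
    · refine ContinuousAt.mul (f := fun p : ℂ × ℂ => dbar Ftil p.1) (g := fun p : ℂ × ℂ =>
        ((p.2.re : ℂ) - p.1)⁻¹) (by fun_prop) (ContinuousAt.inv₀ (by fun_prop) ?_)
      intro h3
      have := him_le z x
      simp only at h3
      rw [h3, norm_zero] at this
      exact h (abs_nonpos_iff.1 this)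
  let bound : ℂ → ℝ := fun z => (tsupport (dbar Ftil)).indicator (fun z => C * |z.im|) z
  have hbound : ∀ z x, ‖G z x‖ ≤ bound z := by
    intro z x
    by_cases h : z ∈ tsupport (dbar Ftil)
    · simp only [bound, Set.indicator_of_mem h]; exact hGb z x
    · simp only [bound, Set.indicator_of_notMem h]
      simp [G, image_eq_zero_of_notMem_tsupport h]
  have hbi : Integrable bound := by
    rw [show bound = (tsupport (dbar Ftil)).indicator (fun z => C * |z.im|) from rfl,
      integrable_indicator_iff hds.isCompact.isClosed.measurableSet]
    exact Continuous.continuousOn (by fun_prop) |>.integrableOn_compact hds.isCompact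
  have hcfcint : cfc (fun x => ∫ z, G z x) B = ∫ z, cfc (G z) B :=
    cfc_integral G bound B hGc.continuousOn (.of_forall fun z x _ => hbound z x)
      hbi.hasFiniteIntegral hN
  have hint : Integrable (fun z => cfc (G z) B) :=
    integrable_cfc G bound B hGc.continuousOn (.of_forall fun z x _ => hbound z x)
      hbi.hasFiniteIntegral hN
  have hcontint : ContinuousOn (fun x => ∫ z, G z x) (spectrum ℂ B) := by
    refine Continuous.continuousOn ?_
    refine continuous_of_dominated (bound := bound) ?_ (fun x => .of_forall fun z => hbound z x)
      hbi (.of_forall fun z => ?_)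
    · intro x
      exact (hGc.comp (by fun_prop : Continuous fun z : ℂ => (z, x))).aestronglyMeasurable
    · exact hGc.comp (by fun_prop : Continuous fun x : ℂ => (z, x))
  have hrep : cfc (fun x : ℂ => F x.re) B = (Real.pi : ℂ)⁻¹ • ∫ z, cfc (G z) B := by
    rw [← hcfcint, ← cfc_const_mul _ _ _ hcontint]
    congr 1
    funext x
    rw [← hext, pompeiu Ftil hFt1 hFtsupp]
    simp only [G, div_eq_mul_inv]
  have hcomm : H * cfc (fun x : ℂ => F x.re) B - cfc (fun x : ℂ => F x.re) B * H
      = (Real.pi : ℂ)⁻¹ • ∫ z, (H * cfc (G z) B - cfc (G z) B * H) := by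
    rw [hrep, integral_sub (hint.const_mul H) (hint.mul_const H), smul_sub]
    rw [mul_smul_comm, smul_mul_assoc]
    congr 2
    · exact ((ContinuousLinearMap.mul ℂ (𝓗 →L[ℂ] 𝓗) H).integral_comp_comm hint).symm
    · exact (((ContinuousLinearMap.mul ℂ (𝓗 →L[ℂ] 𝓗)).flip H).integral_comp_comm hint).symm
  have hpt : ∀ z, ‖H * cfc (G z) B - cfc (G z) B * H‖
      ≤ (1 + ‖z‖ ^ 2) ^ ((-2 - ε) / 2) * (S * ‖H * B - B * H‖) := by
    intro z
    have hle : (1 + ‖z‖ ^ 2) ^ ((ε + 2) / 2) * (|z.im| ^ 2)⁻¹ * ‖dbar Ftil z‖ ≤ S :=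
      le_ciSup hbdd z
    have hS0 : 0 ≤ S := le_trans (by positivity) hle
    by_cases h : z.im = 0
    · have : G z = fun _ => 0 := by funext x; simp [G, hreal z h]
      rw [this, cfc_const_zero]
      simp only [mul_zero, zero_mul, sub_zero, norm_zero]
      positivity
    have hcR : Continuous (fun x : ℂ => ((x.re : ℂ) - z)⁻¹) := by
      refine Continuous.inv₀ (by fun_prop) fun x h3 => ?_
      have := him_le z x
      rw [h3, norm_zero] at this
      exact h (abs_nonpos_iff.1 this)
    have hG : cfc (G z) B = dbar Ftil z • cfc (fun x : ℂ => ((x.re : ℂ) - z)⁻¹) B := by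
      rw [← cfc_const_mul _ _ _ hcR.continuousOn]
    rw [hG, mul_smul_comm, smul_mul_assoc, ← smul_sub, norm_smul]
    have hw : (1 + ‖z‖ ^ 2) ^ ((-2 - ε) / 2) * (1 + ‖z‖ ^ 2) ^ ((ε + 2) / 2) = 1 := by
      rw [← Real.rpow_add (by positivity)]
      ring_nf
      simp
    calc _ ≤ ‖dbar Ftil z‖ * ((|z.im| ^ 2)⁻¹ * ‖H * B - B * H‖) := by
          gcongr; exact resolvent_facts B H hB z h
      _ = (1 + ‖z‖ ^ 2) ^ ((-2 - ε) / 2) *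
          (((1 + ‖z‖ ^ 2) ^ ((ε + 2) / 2) * (|z.im| ^ 2)⁻¹ * ‖dbar Ftil z‖) *
            ‖H * B - B * H‖) := by
          linear_combination (-‖dbar Ftil z‖ * ((|z.im| ^ 2)⁻¹ * ‖H * B - B * H‖)) * hw
      _ ≤ _ := by gcongr
  rw [hcomm, norm_smul, norm_inv, Complex.norm_real, Real.norm_of_nonneg Real.pi_pos.le]
  have := norm_integral_le_of_norm_le (hI1.mul_const (S * ‖H * B - B * H‖)) (.of_forall hpt)
  rw [integral_mul_const] at this
  calc _ ≤ Real.pi⁻¹ * ((∫ z : ℂ, (1 + ‖z‖ ^ 2) ^ ((-2 - ε) / 2)) * (S * ‖H * B - B * H‖)) := by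
        gcongr
    _ = _ := by ring
end

section
/- Symmetrization identity with second-commutator remainder (bounded version): Let 𝓗 be a complex Hilbert space, B and D bounded self-adjoint operators on 𝓗, F : ℝ → ℂ a compactly supported smooth function, and F̃ an almost analytic extension of F. Then -π^{-1} ∫_ℂ (∂̄F̃)(z) (B - z)^{-1} D (B - z)^{-1} du dv = (1/2)(F'(B) D + D F'(B)) + R₁, where R₁ = (2π)^{-1} ∫_ℂ (∂̄F̃)(z) (B - z)^{-2} [[D, B], B] (B - z)^{-2} du dv and [S, T] = ST - TS. -/
open MeasureTheory

lemma dbar_zero_of_notMem (f : ℂ → ℂ) {z : ℂ} (hz : z ∉ tsupport f) : dbar f z = 0 := by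
  have h : fderiv ℝ f z = 0 := by
    have := (tsupport_fderiv_subset ℝ (f := f))
    exact image_eq_zero_of_notMem_tsupport (fun h => hz (this h))
  simp [dbar, h]

lemma continuous_dbar (f : ℂ → ℂ) (hf : ContDiff ℝ (⊤ : ℕ∞) f) : Continuous (dbar f) := by
  have h : Continuous (fderiv ℝ f) := hf.continuous_fderiv (by simp)
  unfold dbar
  fun_prop

lemma dbar_bound (f : ℂ → ℂ) (hsupp : HasCompactSupport f)
    (haa : ∀ k : ℕ, ∃ C : ℝ, ∀ z : ℂ, ‖dbar f z‖ ≤ C * |z.im| ^ k) (k : ℕ) :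
    ∃ g : ℂ → ℝ, Integrable g ∧ (∀ z, 0 ≤ g z) ∧ ∀ z, ‖dbar f z‖ ≤ g z * |z.im| ^ k := by
  obtain ⟨C, hC⟩ := haa k
  refine ⟨(tsupport f).indicator (fun _ => |C|), ?_, ?_, ?_⟩
  · rw [integrable_indicator_iff (isClosed_tsupport f).measurableSet]
    exact integrableOn_const hsupp.isCompact.measure_lt_top.ne
  · intro z; exact Set.indicator_nonneg (fun _ _ => abs_nonneg _) z
  · intro z
    by_cases hz : z ∈ tsupport f
    · rw [Set.indicator_of_mem hz]
      exact (hC z).trans (by gcongr; exact le_abs_self C)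
    · simp [dbar_zero_of_notMem f hz, Set.indicator_of_notMem hz]

lemma dbar_zero_of_im (f : ℂ → ℂ)
    (haa : ∀ k : ℕ, ∃ C : ℝ, ∀ z : ℂ, ‖dbar f z‖ ≤ C * |z.im| ^ k) {z : ℂ} (hz : z.im = 0) :
    dbar f z = 0 := by
  obtain ⟨C, hC⟩ := haa 1
  have := hC z
  simpa [hz] using this

lemma measurableSet_S : MeasurableSet {z : ℂ | z.im ≠ 0} :=
  (isOpen_ne.preimage Complex.continuous_im).measurableSet

/-- general integrability -/
lemma integrable_dbar_smul {E : Type*} [NormedAddCommGroup E] [NormedSpace ℂ E]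
    (f : ℂ → ℂ) (hf : ContDiff ℝ (⊤ : ℕ∞) f) (hsupp : HasCompactSupport f)
    (haa : ∀ k : ℕ, ∃ C : ℝ, ∀ z : ℂ, ‖dbar f z‖ ≤ C * |z.im| ^ k)
    (T : ℂ → E) (hT : ContinuousOn T {z : ℂ | z.im ≠ 0}) (K : ℝ) (k : ℕ)
    (hK : ∀ z : ℂ, z.im ≠ 0 → ‖T z‖ ≤ K * (|z.im| ^ k)⁻¹) :
    Integrable (fun z => dbar f z • T z) := by
  obtain ⟨g, hg, hg0, hgb⟩ := dbar_bound f hsupp haa k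
  have hon : IntegrableOn (fun z => dbar f z • T z) {z : ℂ | z.im ≠ 0} := by
    refine Integrable.mono' (hg.mul_const K).integrableOn
      (((continuous_dbar f hf).continuousOn.smul hT).aestronglyMeasurable measurableSet_S) ?_
    refine (ae_restrict_iff' measurableSet_S).2 (Filter.Eventually.of_forall fun z hz => ?_)
    have h0 : 0 < |z.im| ^ k := pow_pos (abs_pos.2 hz) k
    rw [norm_smul]
    calc ‖dbar f z‖ * ‖T z‖ ≤ (g z * |z.im| ^ k) * (K * (|z.im| ^ k)⁻¹) := by
          gcongr
          · exact mul_nonneg (hg0 z) h0.le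
          · exact hgb z
          · exact hK z hz
      _ = g z * K := by field_simp
  rw [← integrable_indicator_iff measurableSet_S] at hon
  refine hon.congr (Filter.Eventually.of_forall fun z => ?_)
  by_cases hz : z.im = 0
  · simp [hz, dbar_zero_of_im f haa hz]
  · simp [hz]

/-- Polar derivative identity -/
lemma dbar_polar (L : ℂ →L[ℝ] ℂ) (r θ : ℝ) (hr : 0 < r) :
    r • ((1 / 2) * (L 1 + Complex.I * L Complex.I) *
      (-(r * Complex.exp (θ * Complex.I)))⁻¹) =
    (-1 / 2 : ℂ) * (L (Complex.exp (θ * Complex.I)) +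
      Complex.I * L (Complex.I * Complex.exp (θ * Complex.I))) := by
  have hr' : (r : ℂ) ≠ 0 := by exact_mod_cast hr.ne'
  have h1 : Complex.exp (θ * Complex.I) = Real.cos θ • (1 : ℂ) + Real.sin θ • Complex.I := by
    rw [Complex.exp_mul_I]; simp
  have h2 : Complex.I * Complex.exp (θ * Complex.I) =
      (-Real.sin θ) • (1 : ℂ) + Real.cos θ • Complex.I := by
    rw [Complex.exp_mul_I]
    simp
    linear_combination (Complex.sin θ) * Complex.I_sq
  have h3 : (Complex.exp (θ * Complex.I))⁻¹ = Complex.cos θ - Complex.sin θ * Complex.I := by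
    rw [← Complex.exp_neg, ← neg_mul, Complex.exp_mul_I]; simp; ring
  rw [h2, ← neg_mul, mul_inv, h3, h1]
  simp only [map_add, map_smul]
  simp only [Complex.real_smul]
  push_cast
  field_simp
  ring_nf
  simp only [Complex.I_sq]
  ring

lemma integrableOn_polar (f : ℂ → ℂ) (hsupp : HasCompactSupport f) (x : ℂ)
    (A : ℝ × ℝ → ℂ) (hA : Continuous A)
    (hA0 : ∀ p : ℝ × ℝ, x + p.1 * Complex.exp (p.2 * Complex.I) ∉ tsupport f → A p = 0) :
    IntegrableOn A (Set.Ioi 0 ×ˢ Set.Ioo (-Real.pi) Real.pi) := by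
  obtain ⟨M, hM⟩ := hsupp.isCompact.isBounded.subset_closedBall x
  have hc : IntegrableOn A (Set.Icc 0 M ×ˢ Set.Icc (-Real.pi) Real.pi) :=
    hA.continuousOn.integrableOn_compact (isCompact_Icc.prod isCompact_Icc)
  refine IntegrableOn.of_forall_sdiff_eq_zero hc
    (measurableSet_Ioi.prod measurableSet_Ioo) ?_
  rintro ⟨r, θ⟩ ⟨⟨hr, hθ⟩, hn⟩
  apply hA0
  intro hmem
  have := hM hmem
  simp only [Metric.mem_closedBall, dist_self_add_left, norm_mul, Complex.norm_exp_ofReal_mul_I,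
    Complex.norm_real, mul_one] at this
  exact hn ⟨⟨le_of_lt hr, (le_abs_self r).trans this⟩, Set.Ioo_subset_Icc_self hθ⟩

lemma cauchy_pompeiu (f : ℂ → ℂ) (hf : ContDiff ℝ (⊤ : ℕ∞) f) (hsupp : HasCompactSupport f)
    (x : ℂ) : ∫ z : ℂ, dbar f z * (x - z)⁻¹ = Real.pi * f x := by
  have hfd : Differentiable ℝ f := hf.differentiable (by simp)
  have hL : Continuous (fderiv ℝ f) := hf.continuous_fderiv (by simp)
  have hL0 : ∀ z, z ∉ tsupport f → fderiv ℝ f z = 0 := fun z hz =>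
    image_eq_zero_of_notMem_tsupport (fun h => hz (tsupport_fderiv_subset ℝ (f := f) h))
  set e : ℝ → ℂ := fun θ => Complex.exp (θ * Complex.I) with he
  have hec : Continuous e := by fun_prop
  set A1 : ℝ × ℝ → ℂ := fun p => fderiv ℝ f (x + p.1 * e p.2) (e p.2) with hA1
  set A2 : ℝ × ℝ → ℂ := fun p => fderiv ℝ f (x + p.1 * e p.2) (Complex.I * e p.2) with hA2
  have hA1c : Continuous A1 := by
    have h : Continuous fun p : ℝ × ℝ => fderiv ℝ f (x + p.1 * e p.2) := hL.comp (by fun_prop)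
    exact h.clm_apply (by fun_prop)
  have hA2c : Continuous A2 := by
    have h : Continuous fun p : ℝ × ℝ => fderiv ℝ f (x + p.1 * e p.2) := hL.comp (by fun_prop)
    exact h.clm_apply (by fun_prop)
  have hI1 := integrableOn_polar f hsupp x A1 hA1c (fun p hp => by simp [hA1, he, hL0 _ hp])
  have hI2 := integrableOn_polar f hsupp x A2 hA2c (fun p hp => by simp [hA2, he, hL0 _ hp])
  -- radial integral
  have hrad : ∫ p in Set.Ioi (0:ℝ) ×ˢ Set.Ioo (-Real.pi) Real.pi, A1 p = -(2 * Real.pi * f x) := by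
    rw [Measure.volume_eq_prod, ← setIntegral_prod_swap, setIntegral_prod]
    · have : ∀ θ : ℝ, ∫ r in Set.Ioi (0:ℝ), A1 (r, θ) = - f x := by
        intro θ
        have hd : ∀ r : ℝ, HasDerivAt (fun r : ℝ => f (x + r * e θ)) (A1 (r, θ)) r := by
          intro r
          have h1 : HasDerivAt (fun r : ℝ => x + r * e θ) (e θ) r := by
            simpa using ((Complex.ofRealCLM.hasDerivAt (x := r)).mul_const (e θ)).const_add x
          exact (hfd _).hasFDerivAt.comp_hasDerivAt r h1
        obtain ⟨M, hM⟩ := hsupp.isCompact.isBounded.subset_closedBall x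
        have hz : ∀ r : ℝ, max M 0 < r → x + r * e θ ∉ tsupport f := by
          intro r hr hmem
          have := hM hmem
          simp only [Metric.mem_closedBall, dist_self_add_left, norm_mul, he,
            Complex.norm_exp_ofReal_mul_I, Complex.norm_real, mul_one] at this
          have h3 := (le_abs_self r).trans this
          have := le_max_left M 0
          linarith
        have hInt : IntegrableOn (fun r => A1 (r, θ)) (Set.Ioi 0) := by
          have hc : IntegrableOn (fun r => A1 (r, θ)) (Set.Icc 0 (max M 0)) :=
            (hA1c.comp (by fun_prop : Continuous fun r : ℝ => (r, θ))).continuousOn.integrableOn_compact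
              isCompact_Icc
          refine IntegrableOn.of_forall_sdiff_eq_zero hc measurableSet_Ioi ?_
          rintro r ⟨hr, hn⟩
          have : max M 0 < r := by
            by_contra h
            exact hn ⟨le_of_lt hr, not_lt.1 h⟩
          simp [hA1, hL0 _ (hz r this)]
        have := integral_Ioi_of_hasDerivAt_of_tendsto' (a := (0:ℝ)) (m := 0)
          (fun r _ => hd r) hInt ?_
        · rw [this]; simp
        · refine tendsto_const_nhds.congr' ?_
          filter_upwards [Filter.eventually_gt_atTop (max M 0)] with r hr
          exact (image_eq_zero_of_notMem_tsupport (hz r hr)).symm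
      simp only [Prod.swap_prod_mk, this]
      rw [setIntegral_const]
      simp [Measure.real, Real.volume_Ioo, ENNReal.toReal_ofReal, Real.pi_pos.le]
      left; ring
    · exact hI1.swap
  have hang : ∫ p in Set.Ioi (0:ℝ) ×ˢ Set.Ioo (-Real.pi) Real.pi, A2 p = 0 := by
    rw [Measure.volume_eq_prod, setIntegral_prod _ hI2]
    refine setIntegral_eq_zero_of_forall_eq_zero fun r hr => ?_
    have hr' : (r : ℂ) ≠ 0 := by exact_mod_cast (ne_of_gt hr)
    have hd : ∀ θ : ℝ, HasDerivAt (fun θ : ℝ => f (x + r * e θ)) (r * A2 (r, θ)) θ := by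
      intro θ
      have h0 : HasDerivAt e (Complex.I * e θ) θ := by
        have := ((Complex.ofRealCLM.hasDerivAt (x := θ)).mul_const Complex.I).cexp
        simpa [he, mul_comm] using this
      have h1 : HasDerivAt (fun θ : ℝ => x + r * e θ) (r • (Complex.I * e θ)) θ := by
        simpa using (h0.const_mul (r : ℂ)).const_add x
      have := (hfd (x + r * e θ)).hasFDerivAt.comp_hasDerivAt θ h1
      rw [map_smul] at this
      rw [Complex.real_smul] at this
      exact this
    have h2 : ∫ θ in (-Real.pi)..Real.pi, (r * A2 (r, θ)) = 0 := by
      rw [intervalIntegral.integral_eq_sub_of_hasDerivAt (fun θ _ => hd θ)]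
      · simp [he, Complex.exp_neg]
      · exact (continuous_const.mul
          (hA2c.comp (by fun_prop : Continuous fun θ : ℝ => (r, θ)))).intervalIntegrable _ _
    rw [intervalIntegral.integral_const_mul, mul_eq_zero, or_iff_right hr',
      intervalIntegral.integral_of_le (by linarith [Real.pi_pos]), integral_Ioc_eq_integral_Ioo] at h2
    exact h2
  calc ∫ z : ℂ, dbar f z * (x - z)⁻¹ = ∫ w : ℂ, dbar f (x + w) * (-w)⁻¹ := by
        rw [← integral_add_left_eq_self _ x]
        simp
    _ = ∫ p in Set.Ioi (0:ℝ) ×ˢ Set.Ioo (-Real.pi) Real.pi,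
          (-1 / 2 : ℂ) * (A1 p + Complex.I * A2 p) := by
        rw [← Complex.integral_comp_polarCoord_symm]
        refine setIntegral_congr_fun (measurableSet_Ioi.prod measurableSet_Ioo) ?_
        rintro ⟨r, θ⟩ ⟨hr, hθ⟩
        have h1 : Complex.polarCoord.symm (r, θ) = r * e θ := by
          rw [Complex.polarCoord_symm_apply, he]
          simp [Complex.exp_mul_I]
        simp only [h1]
        exact dbar_polar (fderiv ℝ f (x + r * e θ)) r θ hr
    _ = Real.pi * f x := by
        rw [integral_const_mul, integral_add hI1 (hI2.const_mul _), integral_const_mul, hrad, hang]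
        ring

lemma F_deriv (F : ℝ → ℂ) (f : ℂ → ℂ) (hf : ContDiff ℝ (⊤ : ℕ∞) f) (hsupp : HasCompactSupport f)
    (hext : ∀ x : ℝ, f (x : ℂ) = F x)
    (haa : ∀ k : ℕ, ∃ C : ℝ, ∀ z : ℂ, ‖dbar f z‖ ≤ C * |z.im| ^ k) (x : ℝ) :
    ∫ z : ℂ, dbar f z * ((x - z)⁻¹) ^ 2 = -(Real.pi * deriv F x) := by
  obtain ⟨g, hg, hg0, hgb⟩ := dbar_bound f hsupp haa 2
  have hne : ∀ (y : ℝ) (z : ℂ), z.im ≠ 0 → (y : ℂ) - z ≠ 0 := by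
    intro y z hz h
    apply hz
    simpa using congrArg Complex.im h
  have hb : ∀ (y : ℝ) (z : ℂ), z.im ≠ 0 → ‖((y : ℂ) - z)⁻¹‖ ≤ |z.im|⁻¹ := by
    intro y z hz
    rw [norm_inv]
    gcongr
    simpa using Complex.abs_im_le_norm ((y : ℂ) - z)
  have hc : ∀ y : ℝ, ContinuousOn (fun z : ℂ => ((y : ℂ) - z)⁻¹) {z : ℂ | z.im ≠ 0} := fun y =>
    ContinuousOn.inv₀ (by fun_prop) (fun z hz => hne y z hz)
  have hI1 : ∀ y : ℝ, Integrable fun z : ℂ => dbar f z * ((y : ℂ) - z)⁻¹ := fun y =>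
    integrable_dbar_smul f hf hsupp haa _ (hc y) 1 1 (fun z hz => by simpa using hb y z hz)
  have hI2 : ∀ y : ℝ, Integrable fun z : ℂ => dbar f z * (((y : ℂ) - z)⁻¹) ^ 2 := fun y =>
    integrable_dbar_smul f hf hsupp haa _ ((hc y).pow 2) 1 2 (fun z hz => by
      rw [norm_pow, one_mul, ← inv_pow]
      exact pow_le_pow_left₀ (norm_nonneg _) (hb y z hz) 2)
  have key := hasDerivAt_integral_of_dominated_loc_of_deriv_le (μ := (volume : Measure ℂ))
    (F := fun (y : ℝ) (z : ℂ) => dbar f z * ((y : ℂ) - z)⁻¹)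
    (F' := fun (y : ℝ) (z : ℂ) => -(dbar f z * (((y : ℂ) - z)⁻¹) ^ 2))
    (x₀ := x) (s := Set.univ) (bound := g) Filter.univ_mem
    (Filter.Eventually.of_forall fun y => (hI1 y).aestronglyMeasurable) (hI1 x)
    (hI2 x).neg.aestronglyMeasurable ?_ hg ?_
  · have h2 := key.2
    simp only [cauchy_pompeiu f hf hsupp, hext] at h2
    have h3 := h2.const_mul ((Real.pi : ℂ)⁻¹)
    have hpi : (Real.pi : ℂ) ≠ 0 := by exact_mod_cast Real.pi_ne_zero
    simp only [inv_mul_cancel_left₀ hpi] at h3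
    rw [h3.deriv, integral_neg, mul_inv_cancel_left₀ hpi, neg_neg]
  · refine Filter.Eventually.of_forall fun z y _ => ?_
    by_cases hz : z.im = 0
    · simpa [dbar_zero_of_im f haa hz] using hg0 z
    · have h0 : 0 < |z.im| := abs_pos.2 hz
      rw [norm_neg, norm_mul, norm_pow]
      calc _ ≤ (g z * |z.im| ^ 2) * (|z.im|⁻¹) ^ 2 := by
            gcongr
            · exact mul_nonneg (hg0 z) (by positivity)
            · exact hgb z
            · exact hb y z hz
        _ = g z := by field_simp
  · refine Filter.Eventually.of_forall fun z y _ => ?_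
    by_cases hz : z.im = 0
    · simpa [dbar_zero_of_im f haa hz] using hasDerivAt_const y (0 : ℂ)
    · have h1 : HasDerivAt (fun y : ℝ => (y : ℂ) - z) 1 y := by
        simpa using (Complex.ofRealCLM.hasDerivAt (x := y)).sub_const z
      have := (h1.inv (hne y z hz)).const_mul (dbar f z)
      refine HasDerivAt.congr_deriv this ?_
      rw [inv_pow]; ring

section ops
variable {𝓗 : Type*} [NormedAddCommGroup 𝓗] [InnerProductSpace ℂ 𝓗] [CompleteSpace 𝓗]

lemma spec_sub_ne (B : 𝓗 →L[ℂ] 𝓗) (hB : IsSelfAdjoint B) {z : ℂ} (hz : z.im ≠ 0) :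
    ∀ x ∈ spectrum ℂ B, x - z ≠ 0 := by
  intro x hx h
  apply hz
  rw [← sub_eq_zero.1 h]
  exact hB.im_eq_zero_of_mem_spectrum hx

lemma isUnit_sub (B : 𝓗 →L[ℂ] 𝓗) (hB : IsSelfAdjoint B) {z : ℂ} (hz : z.im ≠ 0) :
    IsUnit (B - z • (1 : 𝓗 →L[ℂ] 𝓗)) := by
  have h : z ∉ spectrum ℂ B := fun h => hz (hB.im_eq_zero_of_mem_spectrum h)
  rw [spectrum.notMem_iff, Algebra.algebraMap_eq_smul_one] at h
  rw [← neg_sub]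
  exact h.neg

lemma inverse_eq_cfc (B : 𝓗 →L[ℂ] 𝓗) (hB : IsSelfAdjoint B) {z : ℂ} (hz : z.im ≠ 0) :
    Ring.inverse (B - z • (1 : 𝓗 →L[ℂ] 𝓗)) = cfc (fun x : ℂ => (x - z)⁻¹) B := by
  have hn : IsStarNormal B := hB.isStarNormal
  rw [cfc_inv (fun x : ℂ => x - z) B (spec_sub_ne B hB hz), cfc_sub (fun x : ℂ => x) (fun _ => z) B,
    cfc_id' ℂ B, cfc_const z B, Algebra.algebraMap_eq_smul_one]

lemma cont_inv_sub (B : 𝓗 →L[ℂ] 𝓗) (hB : IsSelfAdjoint B) {z : ℂ} (hz : z.im ≠ 0) :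
    ContinuousOn (fun x : ℂ => (x - z)⁻¹) (spectrum ℂ B) :=
  ContinuousOn.inv₀ (by fun_prop) (spec_sub_ne B hB hz)

lemma norm_inv_sub_le (B : 𝓗 →L[ℂ] 𝓗) (hB : IsSelfAdjoint B) {z : ℂ} (hz : z.im ≠ 0) :
    ∀ x ∈ spectrum ℂ B, ‖(x - z)⁻¹‖ ≤ |z.im|⁻¹ := by
  intro x hx
  have h0 : 0 < |z.im| := abs_pos.2 hz
  rw [norm_inv]
  gcongr
  have := Complex.abs_im_le_norm (x - z)
  simpa [hB.im_eq_zero_of_mem_spectrum hx] using this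

lemma norm_inverse_le (B : 𝓗 →L[ℂ] 𝓗) (hB : IsSelfAdjoint B) {z : ℂ} (hz : z.im ≠ 0) :
    ‖Ring.inverse (B - z • (1 : 𝓗 →L[ℂ] 𝓗))‖ ≤ |z.im|⁻¹ := by
  rw [inverse_eq_cfc B hB hz]
  exact norm_cfc_le (by positivity) (norm_inv_sub_le B hB hz)

lemma continuousOn_inverse (B : 𝓗 →L[ℂ] 𝓗) (hB : IsSelfAdjoint B) :
    ContinuousOn (fun z : ℂ => Ring.inverse (B - z • (1 : 𝓗 →L[ℂ] 𝓗))) {z : ℂ | z.im ≠ 0} := by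
  intro z hz
  obtain ⟨u, hu⟩ := isUnit_sub B hB hz
  have h1 : ContinuousAt Ring.inverse (B - z • (1 : 𝓗 →L[ℂ] 𝓗)) := by
    rw [← hu]; exact NormedRing.inverse_continuousAt u
  have h2 : ContinuousAt (fun z : ℂ => B - z • (1 : 𝓗 →L[ℂ] 𝓗)) z := by fun_prop
  exact (ContinuousAt.comp (f := fun z : ℂ => B - z • (1 : 𝓗 →L[ℂ] 𝓗)) h1 h2).continuousWithinAt

lemma hs_formula (B : 𝓗 →L[ℂ] 𝓗) (hB : IsSelfAdjoint B)
    (F : ℝ → ℂ) (f : ℂ → ℂ) (hf : ContDiff ℝ (⊤ : ℕ∞) f) (hsupp : HasCompactSupport f)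
    (hext : ∀ x : ℝ, f (x : ℂ) = F x)
    (haa : ∀ k : ℕ, ∃ C : ℝ, ∀ z : ℂ, ‖dbar f z‖ ≤ C * |z.im| ^ k) :
    ∫ z : ℂ, dbar f z • Ring.inverse (B - z • (1 : 𝓗 →L[ℂ] 𝓗)) ^ 2 =
      (-Real.pi : ℂ) • cfc (fun z : ℂ => deriv F z.re) B := by
  have hn : IsStarNormal B := hB.isStarNormal
  obtain ⟨g, hg, hg0, hgb⟩ := dbar_bound f hsupp haa 2
  have key := cfc_setIntegral (μ := (volume : Measure ℂ)) measurableSet_S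
    (fun (z x : ℂ) => dbar f z * ((x - z)⁻¹) ^ 2) g B ?_ ?_ hg.integrableOn.2
  · have e1 : cfc (fun x : ℂ => ∫ z in {z : ℂ | z.im ≠ 0}, dbar f z * ((x - z)⁻¹) ^ 2) B =
        cfc (fun x : ℂ => (-Real.pi : ℂ) • deriv F x.re) B := by
      refine cfc_congr fun x hx => ?_
      rw [setIntegral_eq_integral_of_forall_compl_eq_zero]
      · have hx' := hB.mem_spectrum_eq_re hx
        rw [hx', F_deriv F f hf hsupp hext haa]
        simp
      · intro z hz
        rw [dbar_zero_of_im f haa (by simpa using hz), zero_mul]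
    have hFd : Continuous (deriv F) := by
      have hF' : F = f ∘ Complex.ofRealCLM := by ext x; simp [hext]
      have : ContDiff ℝ (⊤ : ℕ∞) F := by
        rw [hF']; exact hf.comp Complex.ofRealCLM.contDiff
      exact this.continuous_deriv (by simp)
    rw [← cfc_smul (-Real.pi : ℂ) (fun z : ℂ => deriv F z.re) B
      (hFd.comp Complex.continuous_re).continuousOn, ← e1, key,
      ← setIntegral_eq_integral_of_forall_compl_eq_zero (s := {z : ℂ | z.im ≠ 0})]
    · refine setIntegral_congr_fun measurableSet_S fun z hz => ?_
      have hc := cont_inv_sub B hB hz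
      rw [inverse_eq_cfc B hB hz, ← cfc_pow (fun x : ℂ => (x - z)⁻¹) 2 B hc,
        ← cfc_const_mul (dbar f z) (fun x : ℂ => ((x - z)⁻¹) ^ 2) B (hc.pow 2)]
    · intro z hz
      rw [dbar_zero_of_im f haa (by simpa using hz), zero_smul]
  · have : ContinuousOn (fun p : ℂ × ℂ => dbar f p.1 * ((p.2 - p.1)⁻¹) ^ 2)
        ({z : ℂ | z.im ≠ 0} ×ˢ spectrum ℂ B) := by
      refine ((continuous_dbar f hf).comp continuous_fst).continuousOn.mul (ContinuousOn.pow ?_ 2)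
      exact ContinuousOn.inv₀ (by fun_prop) (fun p hp => spec_sub_ne B hB hp.1 _ hp.2)
    exact this
  · refine (ae_restrict_iff' measurableSet_S).2 (Filter.Eventually.of_forall fun z hz x hx => ?_)
    have h0 : 0 < |z.im| := abs_pos.2 hz
    rw [norm_mul, norm_pow]
    calc _ ≤ (g z * |z.im| ^ 2) * (|z.im|⁻¹) ^ 2 := by
          gcongr
          · exact mul_nonneg (hg0 z) (by positivity)
          · exact hgb z
          · exact norm_inv_sub_le B hB hz x hx
      _ = g z := by field_simp

/-- the algebraic identity -/
lemma alg_identity {A : Type*} [Ring A] [Algebra ℂ A] (B D R T : A) (z : ℂ)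
    (hT : B = T + z • 1) (h1 : R * T = 1) (h2 : T * R = 1) :
    R * D * R = (1 / 2 : ℂ) • (R ^ 2 * D) + (1 / 2 : ℂ) • (D * R ^ 2) -
      (1 / 2 : ℂ) • (R ^ 2 * ((D * B - B * D) * B - B * (D * B - B * D)) * R ^ 2) := by
  have hc : (D * B - B * D) * B - B * (D * B - B * D) =
      D * T * T - T * D * T - T * D * T + T * T * D := by
    subst hT
    simp only [mul_add, add_mul, mul_sub, sub_mul, smul_mul_assoc, mul_smul_comm, one_mul, mul_one,
      mul_assoc, smul_add, smul_sub]
    abel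
  have h3 : R ^ 2 * (D * T * T - T * D * T - T * D * T + T * T * D) * R ^ 2 =
      R ^ 2 * D + D * R ^ 2 - (2 : ℂ) • (R * D * R) := by
    have a1 : R ^ 2 * (D * T * T) * R ^ 2 = R ^ 2 * D := by
      calc _ = R ^ 2 * D * (T * (T * R) * R) := by noncomm_ring
        _ = _ := by rw [h2, mul_one, h2, mul_one]
    have a2 : R ^ 2 * (T * D * T) * R ^ 2 = R * D * R := by
      calc _ = R * (R * T) * D * (T * R) * R := by noncomm_ring
        _ = _ := by rw [h1, h2, mul_one, mul_one]
    have a3 : R ^ 2 * (T * T * D) * R ^ 2 = D * R ^ 2 := by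
      calc _ = R * (R * T) * T * D * R ^ 2 := by noncomm_ring
        _ = _ := by rw [h1, mul_one, h1, one_mul]
    rw [mul_add, mul_sub, mul_sub, add_mul, sub_mul, sub_mul, a1, a2, a3, two_smul]
    abel
  rw [hc, h3]
  module

end ops
/-- **symmetrization identity with second-commutator remainder, bounded
version.** For bounded self-adjoint `B, D`, compactly supported smooth `F` and an almost
analytic extension `F̃` of `F`:
`-π⁻¹ ∫ (∂̄F̃)(z) (B-z)⁻¹ D (B-z)⁻¹ = (1/2)(F'(B) D + D F'(B)) + R₁` with
`R₁ = (2π)⁻¹ ∫ (∂̄F̃)(z) (B-z)⁻² [[D,B],B] (B-z)⁻²`, where `[S, T] = S T - T S`. -/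
theorem symmetrization_identity_bounded
    {𝓗 : Type*} [NormedAddCommGroup 𝓗] [InnerProductSpace ℂ 𝓗] [CompleteSpace 𝓗]
    (B D : 𝓗 →L[ℂ] 𝓗) (hB : IsSelfAdjoint B) (hD : IsSelfAdjoint D)
    (F : ℝ → ℂ) (hF : ContDiff ℝ (⊤ : ℕ∞) F) (hFsupp : HasCompactSupport F)
    (Ftil : ℂ → ℂ) (hFt : ContDiff ℝ (⊤ : ℕ∞) Ftil) (hFtsupp : HasCompactSupport Ftil)
    (hext : ∀ x : ℝ, Ftil (x : ℂ) = F x)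
    (haa : ∀ k : ℕ, ∃ C : ℝ, ∀ z : ℂ, ‖dbar Ftil z‖ ≤ C * |z.im| ^ k) :
    -(Real.pi)⁻¹ • (∫ z : ℂ, (dbar Ftil z) •
        (Ring.inverse (B - z • 1) * D * Ring.inverse (B - z • 1))) =
      (1 / 2 : ℂ) • (cfc (fun z : ℂ => deriv F z.re) B * D +
          D * cfc (fun z : ℂ => deriv F z.re) B) +
        (2 * Real.pi)⁻¹ • ∫ z : ℂ, (dbar Ftil z) •
          (Ring.inverse (B - z • 1) ^ 2 * ((D * B - B * D) * B - B * (D * B - B * D)) *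
            Ring.inverse (B - z • 1) ^ 2) := by

  set R : ℂ → (𝓗 →L[ℂ] 𝓗) := fun z => Ring.inverse (B - z • (1 : 𝓗 →L[ℂ] 𝓗)) with hR
  set K : 𝓗 →L[ℂ] 𝓗 := (D * B - B * D) * B - B * (D * B - B * D) with hK
  set G : 𝓗 →L[ℂ] 𝓗 := cfc (fun z : ℂ => deriv F z.re) B with hG
  have hHS : ∫ z : ℂ, dbar Ftil z • R z ^ 2 = (-Real.pi : ℂ) • G :=
    hs_formula B hB F Ftil hFt hFtsupp hext haa
  have hRc : ContinuousOn R {z : ℂ | z.im ≠ 0} := continuousOn_inverse B hB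
  have hRb : ∀ z : ℂ, z.im ≠ 0 → ‖R z ^ 2‖ ≤ (|z.im|⁻¹) ^ 2 := fun z hz =>
    (norm_pow_le' _ (by norm_num)).trans
      (pow_le_pow_left₀ (norm_nonneg _) (norm_inverse_le B hB hz) 2)
  have hI2 : Integrable fun z : ℂ => dbar Ftil z • R z ^ 2 :=
    integrable_dbar_smul Ftil hFt hFtsupp haa _ (hRc.pow 2) 1 2 (fun z hz => by
      simpa using hRb z hz)
  have hI4 : Integrable fun z : ℂ => dbar Ftil z • (R z ^ 2 * K * R z ^ 2) := by
    refine integrable_dbar_smul Ftil hFt hFtsupp haa _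
      (((hRc.pow 2).mul continuousOn_const).mul (hRc.pow 2)) ‖K‖ 4 (fun z hz => ?_)
    calc ‖R z ^ 2 * K * R z ^ 2‖ ≤ ‖R z ^ 2‖ * ‖K‖ * ‖R z ^ 2‖ :=
          (norm_mul_le _ _).trans (by gcongr; exact norm_mul_le _ _)
      _ ≤ (|z.im|⁻¹) ^ 2 * ‖K‖ * (|z.im|⁻¹) ^ 2 := by
          gcongr
          · exact hRb z hz
          · exact hRb z hz
      _ = ‖K‖ * (|z.im| ^ 4)⁻¹ := by rw [← inv_pow]; ring
  have hIl : Integrable fun z : ℂ => (dbar Ftil z • R z ^ 2) * D := hI2.mul_const D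
  have hIr : Integrable fun z : ℂ => D * (dbar Ftil z • R z ^ 2) := hI2.const_mul D
  have hpt : ∀ z : ℂ, dbar Ftil z • (R z * D * R z) =
      (1 / 2 : ℂ) • ((dbar Ftil z • R z ^ 2) * D) + (1 / 2 : ℂ) • (D * (dbar Ftil z • R z ^ 2)) -
        (1 / 2 : ℂ) • (dbar Ftil z • (R z ^ 2 * K * R z ^ 2)) := by
    intro z
    by_cases hz : z.im = 0
    · simp [dbar_zero_of_im Ftil haa hz]
    · have hu := isUnit_sub B hB hz
      rw [alg_identity B D (R z) (B - z • 1) z (by simp) (Ring.inverse_mul_cancel _ hu)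
        (Ring.mul_inverse_cancel _ hu), smul_mul_assoc, mul_smul_comm]
      module
  have hleft : ∫ z : ℂ, (dbar Ftil z • R z ^ 2) * D = (-Real.pi : ℂ) • (G * D) := by
    rw [integral_mul_const_of_integrable hI2, hHS, smul_mul_assoc]
  have hright : ∫ z : ℂ, D * (dbar Ftil z • R z ^ 2) = (-Real.pi : ℂ) • (D * G) := by
    rw [integral_const_mul_of_integrable hI2, hHS, mul_smul_comm]
  have hmain : ∫ z : ℂ, dbar Ftil z • (R z * D * R z) =
      (1 / 2 : ℂ) • ((-Real.pi : ℂ) • (G * D)) + (1 / 2 : ℂ) • ((-Real.pi : ℂ) • (D * G)) -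
        (1 / 2 : ℂ) • ∫ z : ℂ, dbar Ftil z • (R z ^ 2 * K * R z ^ 2) := by
    have j1 : Integrable fun z : ℂ => (1 / 2 : ℂ) • ((dbar Ftil z • R z ^ 2) * D) := hIl.smul (1 / 2 : ℂ)
    have j2 : Integrable fun z : ℂ => (1 / 2 : ℂ) • (D * (dbar Ftil z • R z ^ 2)) := hIr.smul (1 / 2 : ℂ)
    have j3 : Integrable fun z : ℂ => (1 / 2 : ℂ) • (dbar Ftil z • (R z ^ 2 * K * R z ^ 2)) :=
      hI4.smul (1 / 2 : ℂ)
    have j12 : Integrable fun z : ℂ => (1 / 2 : ℂ) • ((dbar Ftil z • R z ^ 2) * D) +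
        (1 / 2 : ℂ) • (D * (dbar Ftil z • R z ^ 2)) := j1.add j2
    rw [integral_congr_ae (Filter.Eventually.of_forall hpt), integral_sub j12 j3,
      integral_add j1 j2, integral_smul, integral_smul, integral_smul, hleft, hright]
  change -(Real.pi)⁻¹ • (∫ z : ℂ, dbar Ftil z • (R z * D * R z)) =
    (1 / 2 : ℂ) • (G * D + D * G) + (2 * Real.pi)⁻¹ •
      ∫ z : ℂ, dbar Ftil z • (R z ^ 2 * K * R z ^ 2)
  rw [hmain]
  generalize (∫ z : ℂ, dbar Ftil z • (R z ^ 2 * K * R z ^ 2)) = X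
  have hpi : (Real.pi : ℂ) ≠ 0 := by exact_mod_cast Real.pi_ne_zero
  have hrs : ∀ (r : ℝ) (Y : 𝓗 →L[ℂ] 𝓗), r • Y = (r : ℂ) • Y := fun r Y => (Complex.coe_smul r Y).symm
  rw [hrs, hrs]
  push_cast
  match_scalars <;> field_simp
end
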